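/- (Burnside) Let G be a finite group and let χ be the character of a finite-dimensional irreducible complex representation of G with χ(1) > 1 (i.e., the representation has dimension greater than 1). Then there exists g ∈ G such that χ(g) = 0. -/

import Mathlib

open CategoryTheory

open Polynomial in
/-- If `f ^ n = 1` and `ζ` is a primitive `n`-th root of unity, then there is a single integer
polynomial whose value at `ζ ^ k` is the trace of `f ^ k`, for every `k`. -/
theorem exists_aeval_pow_eq_trace_pow {K V : Type*} [Field K] [CharZero K] [IsAlgClosed K]
    [AddCommGroup V] [Module K V] [FiniteDimensional K V] {n : ℕ} [NeZero n] {ζ : K}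
    (hζ : IsPrimitiveRoot ζ n) (f : Module.End K V) (hf : f ^ n = 1) :
    ∃ p : ℤ[X], ∀ k : ℕ, LinearMap.trace K V (f ^ k) = aeval (ζ ^ k) p := by
  classical
  have hss : f.IsSemisimple := by
    refine Module.End.isSemisimple_of_squarefree_aeval_eq_zero (p := X ^ n - 1)
      (X_pow_sub_one_separable_iff.mpr (NeZero.ne _)).squarefree ?_
    simp [hf]
  have hint : DirectSum.IsInternal f.eigenspace :=
    (DirectSum.isInternal_submodule_iff_iSupIndep_and_iSup_eq_top _).mpr
      ⟨f.eigenspaces_iSupIndep, hss.iSup_eigenspace_eq_top⟩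
  have hfin : {μ | f.eigenspace μ ≠ ⊥}.Finite :=
    WellFoundedGT.finite_ne_bot_of_iSupIndep f.eigenspaces_iSupIndep
  have hpow : ∀ μ (k : ℕ) (v : V), v ∈ f.eigenspace μ → (f ^ k) v = μ ^ k • v := by
    intro μ k v hv
    rw [Module.End.mem_eigenspace_iff] at hv
    induction k with
    | zero => simp
    | succ k ih => rw [pow_succ', Module.End.mul_apply, ih, map_smul, hv, smul_smul, pow_succ]
  have hroot : ∀ μ, f.eigenspace μ ≠ ⊥ → ∃ i < n, ζ ^ i = μ := by
    intro μ hμ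
    obtain ⟨v, hv, hv0⟩ := Submodule.exists_mem_ne_zero_of_ne_bot hμ
    refine hζ.eq_pow_of_pow_eq_one ?_
    have h := hpow μ n v hv
    rw [hf, Module.End.one_apply] at h
    exact smul_left_injective K hv0 (by simpa using h.symm)
  choose! i _ hi using hroot
  refine ⟨∑ μ ∈ hfin.toFinset, C (Module.finrank K (f.eigenspace μ) : ℤ) * X ^ i μ, fun k ↦ ?_⟩
  have hmaps : ∀ μ, Set.MapsTo (f ^ k) (f.eigenspace μ) (f.eigenspace μ) := fun μ v hv ↦ by
    rw [SetLike.mem_coe, hpow μ k v hv]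
    exact Submodule.smul_mem _ _ hv
  rw [LinearMap.trace_eq_sum_trace_restrict' hint hfin hmaps, map_sum]
  refine Finset.sum_congr rfl fun μ hμ ↦ ?_
  have hres : (f ^ k).restrict (hmaps μ) = μ ^ k • LinearMap.id := by
    ext v
    exact hpow μ k v v.2
  rw [hres, map_smul, LinearMap.trace_id, map_mul, aeval_C, map_pow, aeval_X, ← pow_mul,
    mul_comm k, pow_mul, hi μ (by simpa using hμ)]
  simp [mul_comm]

open Polynomial in
/-- A value at a primitive `n`-th root of unity `ζ` of an integer polynomial that takes the same
value at all powers of `ζ` with exponent coprime to `n` is an integer. -/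
theorem exists_int_eq_aeval_of_coprime_pow {K : Type*} [Field K] [CharZero K] {n : ℕ} [NeZero n]
    {ζ : K} (hζ : IsPrimitiveRoot ζ n) (p : ℤ[X])
    (h : ∀ m : ℕ, m.Coprime n → aeval (ζ ^ m) p = aeval ζ p) :
    ∃ z : ℤ, aeval ζ p = (z : K) := by
  let _ : Algebra ℚ K := DivisionRing.toRatAlgebra
  let L := IntermediateField.adjoin ℚ {ζ}
  have : IsCyclotomicExtension {n} ℚ L :=
    (IntermediateField.isCyclotomicExtension_singleton_iff_eq_adjoin n ℚ K _ hζ).mpr rfl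
  have : FiniteDimensional ℚ L := IsCyclotomicExtension.finiteDimensional {n} ℚ L
  have : IsGalois ℚ L := IsCyclotomicExtension.isGalois {n} ℚ L
  let ω : L := IntermediateField.AdjoinSimple.gen ℚ ζ
  let φ : L →ₐ[ℤ] K := (algebraMap L K).toIntAlgHom
  have hφ : Function.Injective φ := (algebraMap L K).injective
  have hφω : φ ω = ζ := IntermediateField.AdjoinSimple.algebraMap_gen ℚ ζ
  have hω : IsPrimitiveRoot ω n := IsPrimitiveRoot.of_map_of_injective (f := φ)
    (by rwa [hφω]) hφ
  obtain ⟨q, hq⟩ : aeval ω p ∈ Set.range (algebraMap ℚ L) := by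
    rw [IsGalois.mem_range_algebraMap_iff_fixed]
    intro σ
    obtain ⟨m, -, hm, hσ⟩ := hω.isPrimitiveRoot_iff.mp (hω.map_of_injective σ.injective)
    have hσp : σ (aeval ω p) = aeval (σ ω) p :=
      (aeval_algHom_apply (σ : L →+* L).toIntAlgHom ω p).symm
    apply hφ
    rw [hσp, ← hσ, ← aeval_algHom_apply, ← aeval_algHom_apply, map_pow, hφω, h m hm]
  have hint : IsIntegral ℤ (aeval ω p) :=
    .of_mem_of_fg _ (hω.isIntegral (NeZero.pos n)).fg_adjoin_singleton _
      (aeval_mem_adjoin_singleton ℤ ω)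
  rw [← hq, isIntegral_algebraMap_iff (algebraMap ℚ L).injective] at hint
  obtain ⟨z, rfl⟩ := IsIntegrallyClosed.isIntegral_iff.mp hint
  refine ⟨z, ?_⟩
  rw [← hφω, aeval_algHom_apply, ← hq]
  simp

/-- **Burnside.**  If `χ` is the character of an irreducible finite-dimensional
complex representation of a finite group `G` with `χ(1) > 1` (i.e. the
representation has dimension greater than `1`), then `χ` vanishes on some
element of `G`. -/
theorem exists_character_eq_zero_of_nonlinear (G : Type) [Group G] [Fintype G]
    (V : FDRep ℂ G) [Simple V] (hdim : 1 < Module.finrank ℂ V) :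
    ∃ g : G, FDRep.character V g = 0 := by
  classical
  by_contra! hne
  let n := Nat.card G
  have : NeZero n := ⟨Nat.card_pos.ne'⟩
  have hnC : (n : ℂ) ≠ 0 := NeZero.ne _
  let _ : Invertible (Nat.card G : ℂ) := invertibleOfNonzero hnC
  have hζ := Complex.isPrimitiveRoot_exp n (NeZero.ne n)
  set ζ := Complex.exp (2 * Real.pi * Complex.I / n)
  have hp : ∀ g : G, ∃ p : Polynomial ℤ,
      ∀ k : ℕ, V.character (g ^ k) = Polynomial.aeval (ζ ^ k) p := fun g ↦ by
    obtain ⟨p, hp⟩ := exists_aeval_pow_eq_trace_pow hζ (V.ρ g)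
      (by rw [← map_pow, pow_card_eq_one', map_one])
    exact ⟨p, fun k ↦ by rw [← hp, ← map_pow, FDRep.character]⟩
  choose p hp using hp
  have hp1 : ∀ g, V.character g = Polynomial.aeval ζ (p g) := fun g ↦ by simpa using hp g 1
  -- the values at inverses are complex conjugates
  have hconj : ∀ g, V.character g⁻¹ = starRingEnd ℂ (V.character g) := fun g ↦ by
    have hg : g⁻¹ = g ^ (n - 1) := by
      rw [inv_eq_iff_mul_eq_one, ← pow_succ', Nat.sub_add_cancel NeZero.one_le, pow_card_eq_one']
    have hz : ζ ^ (n - 1) = starRingEnd ℂ ζ := by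
      rw [← Complex.inv_eq_conj (hζ.norm'_eq_one (NeZero.ne n))]
      refine eq_inv_of_mul_eq_one_left ?_
      rw [← pow_succ, Nat.sub_add_cancel NeZero.one_le, hζ.pow_eq_one]
    rw [hg, hp, hz, hp1]
    exact Polynomial.aeval_algHom_apply (starRingEnd ℂ).toIntAlgHom ζ (p g)
  have hsum : ∑ g : G, ‖V.character g‖ ^ 2 = n := by
    have h := FDRep.char_orthonormal V V
    rw [if_pos ⟨Iso.refl V⟩, inv_mul_eq_one₀ hnC] at h
    simp only [hconj, Complex.mul_conj'] at h
    exact_mod_cast h.symm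
  -- the product over the nonidentity elements is a nonzero integer
  have hprod : 1 ≤ ‖∏ g ∈ Finset.univ.erase (1 : G), V.character g‖ := by
    obtain ⟨z, hz⟩ := exists_int_eq_aeval_of_coprime_pow hζ
      (∏ g ∈ Finset.univ.erase (1 : G), p g) fun m hm ↦ by
        rw [map_prod, map_prod]
        simp only [← hp, ← hp1]
        refine Finset.prod_equiv (powCoprime (G := G) hm.symm) (fun g ↦ ?_) (fun g _ ↦ rfl)
        rw [Finset.mem_erase, Finset.mem_erase, ← powCoprime_one (G := G) hm.symm,
          (powCoprime _).injective.ne_iff]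
        simp
    rw [map_prod] at hz
    simp only [← hp1] at hz
    have hz0 : z ≠ 0 := by
      rintro rfl
      exact Finset.prod_ne_zero_iff.mpr (fun g _ ↦ hne g) (by simpa using hz)
    rw [hz, Complex.norm_intCast]
    exact_mod_cast Int.one_le_abs hz0
  have hlog : 0 ≤ ∑ g ∈ Finset.univ.erase (1 : G), (‖V.character g‖ ^ 2 - 1) := by
    calc 0 ≤ Real.log (‖∏ g ∈ Finset.univ.erase (1 : G), V.character g‖ ^ 2) :=
          Real.log_nonneg (one_le_pow₀ hprod)
      _ = ∑ g ∈ Finset.univ.erase (1 : G), Real.log (‖V.character g‖ ^ 2) := by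
          rw [norm_prod, ← Finset.prod_pow, Real.log_prod]
          exact fun g _ ↦ pow_ne_zero _ (norm_ne_zero_iff.mpr (hne g))
      _ ≤ _ := Finset.sum_le_sum fun g _ ↦
          Real.log_le_sub_one_of_pos (pow_pos (norm_pos_iff.mpr (hne g)) 2)
  have htot : ∑ g : G, (‖V.character g‖ ^ 2 - 1) = 0 := by
    rw [Finset.sum_sub_distrib, hsum]
    simp [n]
  rw [← Finset.add_sum_erase _ _ (Finset.mem_univ (1 : G)), FDRep.char_one,
    Complex.norm_natCast] at htot
  have hd : (1 : ℝ) < Module.finrank ℂ V := by exact_mod_cast hdim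
  nlinarith
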